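/- Suppose n ≥ 3, α ∈ (0,n), λ > 0, and σ > g_α(λ). Let φ : (0,1) → (0,∞) be a continuous function with φ(t) → ∞ as t → 0⁺. Then there exists a nonnegative solution u of the Choquard–Pekar inequality problem such that u(x) ≠ O(φ(|x|)) as x → 0 (i.e., there is a sequence x_j → 0 with u(x_j)/φ(|x_j|) → ∞). -/

import Mathlib

open MeasureTheory Metric Filter Set Asymptotics Topology

/-- `ℝⁿ` as a Euclidean space. -/
abbrev Euc (n : ℕ) : Type := EuclideanSpace ℝ (Fin n)

/-- The Laplacian `Δu(x) = ∑ i ∂²u/∂xᵢ²(x)`. -/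
noncomputable def lap {n : ℕ} (u : Euc n → ℝ) (x : Euc n) : ℝ :=
  ∑ i : Fin n, iteratedFDeriv ℝ 2 u x ![EuclideanSpace.single i 1, EuclideanSpace.single i 1]

/-- `u` is a nonnegative solution of the Choquard–Pekar inequality problem:
`u ∈ C²(ℝⁿ \ {0}) ∩ L^λ(ℝⁿ)` and
`0 ≤ -Δu(x) ≤ (∫ |x-y|^(-α) u(y)^λ dy) · u(x)^σ` on `B₂(0) \ {0}`. -/
def IsCPSolution (n : ℕ) (α lam sig : ℝ) (u : Euc n → ℝ) : Prop :=
  (∀ x, 0 ≤ u x) ∧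
  ContDiffOn ℝ 2 u {0}ᶜ ∧
  Integrable (fun y => u y ^ lam) ∧
  ∀ x ∈ ball (0 : Euc n) 2 \ {0},
    0 ≤ -lap u x ∧
    -lap u x ≤ (∫ y, ‖x - y‖ ^ (-α) * u y ^ lam) * u x ^ sig

/-- The piecewise linear function `g_α`. -/
noncomputable def gAlpha (n : ℕ) (α lam : ℝ) : ℝ :=
  if lam < ((n : ℝ) - α) / ((n : ℝ) - 2) then (n : ℝ) / ((n : ℝ) - 2)
  else if lam < (n : ℝ) / ((n : ℝ) - 2) then (2 * (n : ℝ) - α) / ((n : ℝ) - 2) - lam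
  else max 0 (1 - (α - 2) / (n : ℝ) * lam)

/-- `u(x) ≠ O(φ(|x|))` as `x → 0`: there is a sequence `x_j → 0` with
`u(x_j)/φ(|x_j|) → ∞`. -/
def NotBigOAt (n : ℕ) (u : Euc n → ℝ) (φ : ℝ → ℝ) : Prop :=
  ∃ x : ℕ → Euc n, (∀ j, x j ≠ 0) ∧ Tendsto x atTop (𝓝 0) ∧
    Tendsto (fun j => u (x j) / φ ‖x j‖) atTop atTop

theorem lap_congr {n : ℕ} {f g : Euc n → ℝ} {x : Euc n} (h : f =ᶠ[𝓝 x] g) :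
    lap f x = lap g x := by
  unfold lap
  rw [(h.iteratedFDeriv ℝ 2).eq_of_nhds]

theorem lap_add {n : ℕ} {f g : Euc n → ℝ} {x : Euc n} (hf : ContDiffAt ℝ 2 f x)
    (hg : ContDiffAt ℝ 2 g x) : lap (fun y => f y + g y) x = lap f x + lap g x := by
  unfold lap
  rw [← Finset.sum_add_distrib]
  refine Finset.sum_congr rfl fun i _ => ?_
  have : (fun y => f y + g y) = f + g := rfl
  rw [this, iteratedFDeriv_add_apply hf hg]
  rfl

theorem lap_const_mul {n : ℕ} {f : Euc n → ℝ} {x : Euc n} (c : ℝ) (hf : ContDiffAt ℝ 2 f x) :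
    lap (fun y => c * f y) x = c * lap f x := by
  unfold lap
  rw [Finset.mul_sum]
  have : (fun y => c * f y) = c • f := rfl
  rw [this, iteratedFDeriv_const_smul_apply hf]
  rfl

theorem lap_radial {n : ℕ} {F F₁ F₂ : ℝ → ℝ} (h₁ : ∀ t, HasDerivAt F (F₁ t) t)
    (h₂ : ∀ t, HasDerivAt F₁ (F₂ t) t) (c : ℝ) (p x : Euc n) :
    lap (fun y => F (c * ‖y - p‖ ^ 2)) x =
      c * (4 * (c * ‖x - p‖ ^ 2) * F₂ (c * ‖x - p‖ ^ 2) + 2 * n * F₁ (c * ‖x - p‖ ^ 2)) := by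
  have hq : ∀ y : Euc n, HasFDerivAt (fun y : Euc n => c * ‖y - p‖ ^ 2)
      (c • (2 • (innerSL ℝ (y - p)))) y := by
    intro y
    have := (((hasFDerivAt_id y).sub_const p).norm_sq).const_mul c
    simpa using this
  have hd : ∀ y : Euc n, HasFDerivAt (fun y : Euc n => F (c * ‖y - p‖ ^ 2))
      ((2 * c * F₁ (c * ‖y - p‖ ^ 2)) • innerSL ℝ (y - p)) y := by
    intro y
    have := (h₁ (c * ‖y - p‖ ^ 2)).comp_hasFDerivAt y (hq y)
    refine this.congr_fderiv ?_
    ext v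
    simp
    ring
  obtain ⟨L, hL⟩ : ∃ L : Euc n →L[ℝ] Euc n →L[ℝ] ℝ, ∀ v, L v = innerSL ℝ v :=
    ⟨innerSL ℝ, fun _ => rfl⟩
  have hdd : HasFDerivAt
      (fun y : Euc n => (2 * c * F₁ (c * ‖y - p‖ ^ 2)) • innerSL ℝ (y - p))
      ((2 * c * F₁ (c * ‖x - p‖ ^ 2)) • L +
        ((2 * c) • (F₂ (c * ‖x - p‖ ^ 2) • (c • (2 • (innerSL ℝ (x - p)))))).smulRight
          (innerSL ℝ (x - p))) x := by
    have a := ((h₂ (c * ‖x - p‖ ^ 2)).comp_hasFDerivAt x (hq x)).const_mul (2 * c)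
    have b : HasFDerivAt (fun y : Euc n => L (y - p)) L x := by
      exact L.hasFDerivAt.comp x ((hasFDerivAt_id x).sub_const p)
    simp only [hL] at b
    exact a.smul b
  have he : fderiv ℝ (fun y : Euc n => F (c * ‖y - p‖ ^ 2)) =
      fun y => (2 * c * F₁ (c * ‖y - p‖ ^ 2)) • innerSL ℝ (y - p) :=
    funext fun y => (hd y).fderiv
  have key : ∀ i : Fin n, iteratedFDeriv ℝ 2 (fun y : Euc n => F (c * ‖y - p‖ ^ 2)) x
      ![EuclideanSpace.single i 1, EuclideanSpace.single i 1] =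
      2 * c * F₁ (c * ‖x - p‖ ^ 2) + 4 * c * c * F₂ (c * ‖x - p‖ ^ 2) * ((x - p) i) ^ 2 := by
    intro i
    rw [iteratedFDeriv_two_apply, he, hdd.fderiv]
    simp [EuclideanSpace.inner_single_right, hL]
    ring
  unfold lap
  simp_rw [key]
  have hs : ∑ i, ((x - p) i) ^ 2 = ‖x - p‖ ^ 2 := by
    rw [EuclideanSpace.norm_sq_eq]
    simp
  rw [Finset.sum_add_distrib, Finset.sum_const, ← Finset.mul_sum, hs, Finset.card_univ,
    Fintype.card_fin, nsmul_eq_mul]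
  ring

theorem exists_bound_lap {n : ℕ} {f : Euc n → ℝ} (hf : ContDiff ℝ 2 f)
    (hc : HasCompactSupport f) : ∃ C, 0 ≤ C ∧ ∀ x, |lap f x| ≤ C := by
  have h := hc.iteratedFDeriv (𝕜 := ℝ) 2
  obtain ⟨C, hC⟩ := (hf.continuous_iteratedFDeriv le_rfl).bounded_above_of_compact_support h
  refine ⟨n * C, mul_nonneg (by positivity) ((norm_nonneg _).trans (hC 0)), fun x => ?_⟩
  unfold lap
  refine (Finset.abs_sum_le_sum_abs _ _).trans ?_
  have : ∀ i ∈ (Finset.univ : Finset (Fin n)), |iteratedFDeriv ℝ 2 f x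
      ![EuclideanSpace.single i 1, EuclideanSpace.single i 1]| ≤ C := by
    intro i _
    refine ((iteratedFDeriv ℝ 2 f x).le_opNorm _).trans ?_
    simpa [Fin.prod_univ_two] using hC x
  simpa using Finset.sum_le_card_nsmul _ _ _ this

/-- The profile `t ↦ t ^ (-m)`, continued below `t = 1` by its second Taylor polynomial. -/
noncomputable def profile (m t : ℝ) : ℝ :=
  if t ≤ 1 then 1 - m * (t - 1) + m * (m + 1) / 2 * (t - 1) ^ 2 else t ^ (-m)

/-- The derivative of `profile`. -/
noncomputable def profileDeriv (m t : ℝ) : ℝ :=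
  if t ≤ 1 then -m + m * (m + 1) * (t - 1) else -m * t ^ (-m - 1)

/-- The second derivative of `profile`. -/
noncomputable def profileDeriv₂ (m t : ℝ) : ℝ :=
  if t ≤ 1 then m * (m + 1) else m * (m + 1) * t ^ (-m - 2)

theorem hasDerivAt_ite_le {f g f' g' : ℝ → ℝ} {a : ℝ} (hf : ∀ t, HasDerivAt f (f' t) t)
    (hg : ∀ t, a ≤ t → HasDerivAt g (g' t) t) (h : f a = g a) (h' : f' a = g' a) (t : ℝ) :
    HasDerivAt (fun s => if s ≤ a then f s else g s) (if t ≤ a then f' t else g' t) t := by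
  rcases lt_trichotomy t a with ht | rfl | ht
  · rw [if_pos ht.le]
    refine (hf t).congr_of_eventuallyEq ?_
    filter_upwards [Iio_mem_nhds ht] with s hs
    rw [if_pos (le_of_lt hs)]
  · rw [if_pos le_rfl, ← hasDerivWithinAt_univ, ← Iic_union_Ici (a := t)]
    refine HasDerivWithinAt.union ?_ ?_
    · refine (hf t).hasDerivWithinAt.congr (fun s hs => ?_) ?_
      · exact if_pos hs
      · rw [if_pos le_rfl]
    · rw [h']
      refine (hg t le_rfl).hasDerivWithinAt.congr (fun s hs => ?_) ?_
      · split_ifs with hst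
        · rw [le_antisymm hst hs, h]
        · rfl
      · rw [if_pos le_rfl, h]
  · rw [if_neg (not_le.2 ht)]
    refine (hg t ht.le).congr_of_eventuallyEq ?_
    filter_upwards [Ioi_mem_nhds ht] with s hs
    rw [if_neg (not_le.2 hs)]

theorem hasDerivAt_profile (m t : ℝ) : HasDerivAt (profile m) (profileDeriv m t) t := by
  refine hasDerivAt_ite_le (f := fun t => 1 - m * (t - 1) + m * (m + 1) / 2 * (t - 1) ^ 2)
    (g := fun t => t ^ (-m)) (f' := fun t => -m + m * (m + 1) * (t - 1))
    (g' := fun t => -m * t ^ (-m - 1)) (fun t => ?_) (fun t ht => ?_) ?_ ?_ t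
  · have h := (hasDerivAt_id t).sub_const 1
    have := ((h.const_mul m).const_sub 1).add ((h.pow 2).const_mul (m * (m + 1) / 2))
    refine this.congr_deriv ?_
    simp
    ring
  · exact Real.hasDerivAt_rpow_const (Or.inl (by linarith))
  · simp
  · simp

theorem hasDerivAt_profileDeriv (m t : ℝ) :
    HasDerivAt (profileDeriv m) (profileDeriv₂ m t) t := by
  refine hasDerivAt_ite_le (f := fun t => -m + m * (m + 1) * (t - 1))
    (g := fun t => -m * t ^ (-m - 1)) (f' := fun _ => m * (m + 1))
    (g' := fun t => m * (m + 1) * t ^ (-m - 2)) (fun t => ?_) (fun t ht => ?_) ?_ ?_ t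
  · have h := (hasDerivAt_id t).sub_const 1
    simpa using (h.const_mul (m * (m + 1))).const_add (-m)
  · have := (Real.hasDerivAt_rpow_const (p := -m - 1) (x := t)
      (Or.inl (by linarith))).const_mul (-m)
    refine this.congr_deriv ?_
    rw [show -m - 1 - 1 = -m - 2 by ring]
    ring
  · simp
  · simp

theorem continuous_profileDeriv₂ (m : ℝ) : Continuous (profileDeriv₂ m) := by
  have : profileDeriv₂ m = fun t => m * (m + 1) * (max t 1) ^ (-m - 2) := by
    ext t
    unfold profileDeriv₂
    split_ifs with h
    · simp [max_eq_right h]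
    · rw [max_eq_left (not_le.1 h).le]
  rw [this]
  refine continuous_const.mul ((continuous_id.max continuous_const).rpow_const fun t => Or.inl ?_)
  exact ne_of_gt (lt_max_of_lt_right one_pos)

theorem contDiff_profile (m : ℝ) : ContDiff ℝ 2 (profile m) := by
  rw [show (2 : WithTop ℕ∞) = 1 + 1 by norm_num, contDiff_succ_iff_deriv]
  refine ⟨fun t => (hasDerivAt_profile m t).differentiableAt, by simp, ?_⟩
  rw [show deriv (profile m) = profileDeriv m from funext fun t => (hasDerivAt_profile m t).deriv,
    contDiff_one_iff_deriv]
  refine ⟨fun t => (hasDerivAt_profileDeriv m t).differentiableAt, ?_⟩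
  rw [show deriv (profileDeriv m) = profileDeriv₂ m from
    funext fun t => (hasDerivAt_profileDeriv m t).deriv]
  exact continuous_profileDeriv₂ m

theorem profile_of_one_le {m t : ℝ} (ht : 1 ≤ t) : profile m t = t ^ (-m) := by
  unfold profile
  split_ifs with h
  · simp [le_antisymm h ht]
  · rfl

theorem one_le_profile {m t : ℝ} (hm : 0 < m) (ht : t ≤ 1) : 1 ≤ profile m t := by
  unfold profile
  rw [if_pos ht]
  have : 0 ≤ m * (1 - t) := mul_nonneg hm.le (by linarith)
  have : 0 ≤ m * (m + 1) / 2 * (t - 1) ^ 2 := by positivity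
  linarith

theorem profile_nonneg {m t : ℝ} (hm : 0 < m) : 0 ≤ profile m t := by
  rcases le_total t 1 with h | h
  · exact zero_le_one.trans (one_le_profile hm h)
  · rw [profile_of_one_le h]
    positivity

theorem profile_le {m μ t : ℝ} (hμ : 0 < μ) (hm : μ ≤ m) (ht : 0 < t) :
    profile m t ≤ (1 + m + m * (m + 1) / 2) * t ^ (-μ) := by
  have hm0 : 0 < m := hμ.trans_le hm
  have hA : 1 ≤ 1 + m + m * (m + 1) / 2 := by
    have : 0 < m * (m + 1) / 2 := by positivity
    linarith
  rcases le_total t 1 with h | h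
  · have h1 : 1 ≤ t ^ (-μ) := Real.one_le_rpow_of_pos_of_le_one_of_nonpos ht h (by linarith)
    have h2 : profile m t ≤ 1 + m + m * (m + 1) / 2 := by
      unfold profile
      rw [if_pos h]
      have : (t - 1) ^ 2 ≤ 1 := by nlinarith
      have : m * (m + 1) / 2 * (t - 1) ^ 2 ≤ m * (m + 1) / 2 * 1 := by gcongr
      nlinarith
    calc profile m t ≤ (1 + m + m * (m + 1) / 2) * 1 := by linarith
      _ ≤ _ := by gcongr
  · rw [profile_of_one_le h]
    calc t ^ (-m) ≤ 1 * t ^ (-μ) := by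
          rw [one_mul]; exact Real.rpow_le_rpow_of_exponent_le h (by linarith)
      _ ≤ _ := by gcongr

theorem profile_laplacian {N : ℝ} {t : ℝ} :
    4 * t * profileDeriv₂ ((N - 2) / 2) t + 2 * N * profileDeriv ((N - 2) / 2) t =
      (N - 2) / 2 * N * (N + 2) * min (t - 1) 0 := by
  unfold profileDeriv₂ profileDeriv
  split_ifs with h
  · rw [min_eq_left (by linarith)]
    ring
  · have ht : 0 < t := by linarith [not_le.1 h]
    rw [min_eq_right (by linarith), show -((N - 2) / 2) - 1 = (-((N - 2) / 2) - 2) + 1 by ring,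
      Real.rpow_add_one ht.ne']
    ring

theorem integrableOn_norm_sub_rpow {n : ℕ} (hn : 1 ≤ n) {β : ℝ} (hβ : β < n) (p : Euc n) (ρ : ℝ) :
    IntegrableOn (fun y : Euc n => ‖y - p‖ ^ (-β)) (ball p ρ) := by
  have h : IntegrableOn (fun y : Euc n => ‖y‖ ^ (-β)) (ball 0 ρ) := by
    refine integrableOn_ball_of_norm_le_rpow (C := 1) (α := β) (by simpa using hn)
      (by simpa using hβ) (Eventually.of_forall fun x => ?_) ?_
    · rw [one_mul, Real.norm_of_nonneg (by positivity)]
    · exact (measurable_norm.pow_const (-β)).aestronglyMeasurable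
  rw [← integrable_indicator_iff measurableSet_ball] at h ⊢
  refine (h.comp_sub_right p).congr (Eventually.of_forall fun y => ?_)
  simp [indicator, dist_eq_norm]

theorem eventually_mul_rpow_le {A e η : ℝ} (he : 0 < e) (hη : 0 < η) :
    ∀ᶠ r : ℝ in 𝓝[>] 0, A * r ^ e ≤ η := by
  have h : Tendsto (fun r : ℝ => A * r ^ e) (𝓝 0) (𝓝 (A * 0 ^ e)) :=
    ((Real.continuousAt_rpow_const 0 e (Or.inr he.le)).tendsto).const_mul A
  rw [Real.zero_rpow he.ne', mul_zero] at h
  exact (h.mono_left nhdsWithin_le_nhds).eventually_le_const hη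

theorem inv_sq_rpow_neg {r m : ℝ} (hr : 0 < r) : ((r⁻¹) ^ 2) ^ (-m) = r ^ (2 * m) := by
  rw [← Real.rpow_natCast, ← Real.rpow_mul (by positivity), Real.inv_rpow hr.le,
    ← Real.rpow_neg hr.le]
  congr 1
  push_cast
  ring

/-- Concentrated bumps of height `r ^ (-γ)` and width `r`, supported in a fixed ball, whose
Laplacian is nonpositive on the core and negligible elsewhere. -/
theorem eventually_exists_bump {n : ℕ} (hn : 3 ≤ n) {γ θ lam : ℝ} (hγ : 0 < γ) (hγθ : γ < θ)
    (hθ : θ ≤ n - 2) (hlam : 0 < lam) (hθl : θ * lam < n) (p : Euc n) {d : ℝ} (hd : 0 < d)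
    {η : ℝ} (hη : 0 < η) :
    ∀ᶠ r : ℝ in 𝓝[>] 0, ∃ w : Euc n → ℝ, ContDiff ℝ 2 w ∧ (∀ x, 0 ≤ w x) ∧
      (∀ x, d ≤ ‖x - p‖ → w x = 0) ∧
      (∀ x, ‖x - p‖ ≤ r → r ^ (-γ) ≤ w x ∧ lap w x ≤ 0 ∧
        -lap w x ≤ ((n : ℝ) - 2) / 2 * n * (n + 2) * r ^ (-(γ + 2))) ∧
      (∀ x, r < ‖x - p‖ → |lap w x| ≤ η) ∧
      ∫⁻ x, ENNReal.ofReal (w x ^ lam) ≤ ENNReal.ofReal η := by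
  have hn' : (3 : ℝ) ≤ n := by exact_mod_cast hn
  obtain ⟨m, hm⟩ : ∃ m : ℝ, m = ((n : ℝ) - 2) / 2 := ⟨_, rfl⟩
  have hm0 : 0 < m := by rw [hm]; linarith
  let ψ : ContDiffBump p := ⟨d / 2, d, by positivity, by linarith⟩
  have hψin : ∀ x, ‖x - p‖ ≤ d / 2 → ψ x = 1 := fun x hx =>
    ψ.one_of_mem_closedBall (by rw [mem_closedBall, dist_eq_norm]; exact hx)
  have hψout : ∀ x, d ≤ ‖x - p‖ → ψ x = 0 := fun x hx =>
    ψ.zero_of_le_dist (by rw [dist_eq_norm]; exact hx)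
  have hcd : ∀ c : ℝ, ContDiff ℝ 2 (fun x : Euc n => profile m (c * ‖x - p‖ ^ 2)) := fun c =>
    (contDiff_profile m).comp
      (contDiff_const.mul ((contDiff_id.sub contDiff_const).norm_sq ℝ))
  have hcdψ : ∀ c : ℝ, ContDiff ℝ 2 (fun x : Euc n => profile m (c * ‖x - p‖ ^ 2) * ψ x) :=
    fun c => (hcd c).mul ψ.contDiff
  obtain ⟨CV, hCV0, hCV⟩ := exists_bound_lap (hcdψ (((d / 3)⁻¹) ^ 2))
    (ψ.hasCompactSupport.mul_left)
  set c₀ : ℝ := ((d / 3)⁻¹) ^ 2 with hc₀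
  have hc₀pos : 0 < c₀ := by positivity
  set A : ℝ := 1 + m + m * (m + 1) / 2 with hA
  have hApos : 0 < A := by positivity
  have hintg := integrableOn_norm_sub_rpow (by omega) hθl p d
  set J : ℝ := ∫ y in ball p d, ‖y - p‖ ^ (-(θ * lam)) with hJ
  have hJ' : ∫⁻ y in ball p d, ENNReal.ofReal (‖y - p‖ ^ (-(θ * lam))) = ENNReal.ofReal J :=
    (ofReal_integral_eq_lintegral_ofReal hintg
      (Eventually.of_forall fun y => by positivity)).symm
  have e₁ : ∀ᶠ r : ℝ in 𝓝[>] 0, r < d / 3 :=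
    nhdsWithin_le_nhds (Iio_mem_nhds (by positivity))
  have e₂ := eventually_mul_rpow_le (A := c₀ ^ m * CV) (e := 2 * m - γ)
    (by rw [hm]; linarith) hη
  have e₃ := eventually_mul_rpow_le (A := A ^ lam * J) (e := (θ - γ) * lam)
    (mul_pos (by linarith) hlam) hη
  filter_upwards [e₁, e₂, e₃, self_mem_nhdsWithin] with r hr₁ hr₂ hr₃ (hr : 0 < r)
  set c : ℝ := (r⁻¹) ^ 2 with hc
  have hcpos : 0 < c := by positivity
  have hcr : c * r ^ 2 = 1 := by rw [hc]; field_simp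
  refine ⟨fun x => r ^ (-γ) * (profile m (c * ‖x - p‖ ^ 2) * ψ x),
    contDiff_const.mul (hcdψ c), fun x => ?_, fun x hx => ?_, ?_⟩
  · exact mul_nonneg (by positivity) (mul_nonneg (profile_nonneg hm0) ψ.nonneg)
  · simp [hψout x hx]
  have hlap_in : ∀ x, ‖x - p‖ < d / 2 →
      lap (fun x => r ^ (-γ) * (profile m (c * ‖x - p‖ ^ 2) * ψ x)) x =
        ((n : ℝ) - 2) / 2 * n * (n + 2) * r ^ (-(γ + 2)) * min (c * ‖x - p‖ ^ 2 - 1) 0 := by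
    intro x hx
    have hev : (fun x => r ^ (-γ) * (profile m (c * ‖x - p‖ ^ 2) * ψ x)) =ᶠ[𝓝 x]
        fun x => r ^ (-γ) * profile m (c * ‖x - p‖ ^ 2) := by
      have : ∀ᶠ y in 𝓝 x, ‖y - p‖ < d / 2 :=
        (continuous_id.sub continuous_const).norm.continuousAt.eventually_lt_const hx
      filter_upwards [this] with y hy
      rw [hψin y hy.le, mul_one]
    rw [lap_congr hev, lap_const_mul _ (hcd c).contDiffAt,
      lap_radial (hasDerivAt_profile m) (hasDerivAt_profileDeriv m), hm, profile_laplacian]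
    have : r ^ (-(γ + 2)) = r ^ (-γ) * c := by
      rw [neg_add, Real.rpow_add hr, hc, inv_pow, Real.rpow_neg hr.le 2]
      norm_num
    rw [this]
    ring
  refine ⟨fun x hx => ?_, fun x hx => ?_, ?_⟩
  · have ht : c * ‖x - p‖ ^ 2 ≤ 1 := by rw [← hcr]; gcongr
    have ht0 : 0 ≤ c * ‖x - p‖ ^ 2 := by positivity
    refine ⟨?_, ?_⟩
    · simp only [hψin x (by linarith : ‖x - p‖ ≤ d / 2), mul_one]
      exact le_mul_of_one_le_right (by positivity) (one_le_profile hm0 ht)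
    · rw [hlap_in x (by linarith), min_eq_left (by linarith)]
      have hB : 0 ≤ ((n : ℝ) - 2) / 2 * n * (n + 2) * r ^ (-(γ + 2)) :=
        mul_nonneg (mul_nonneg (mul_nonneg (by linarith) (by linarith)) (by linarith))
          (by positivity)
      constructor <;> nlinarith
  · rcases lt_or_ge ‖x - p‖ (d / 2) with hxd | hxd
    · have ht : 1 ≤ c * ‖x - p‖ ^ 2 := by rw [← hcr]; gcongr
      rw [hlap_in x hxd, min_eq_right (by linarith)]
      simpa using hη.le
    · have hev : (fun x => r ^ (-γ) * (profile m (c * ‖x - p‖ ^ 2) * ψ x)) =ᶠ[𝓝 x]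
          fun x => (c₀ ^ m * r ^ (2 * m - γ)) * (profile m (c₀ * ‖x - p‖ ^ 2) * ψ x) := by
        have : ∀ᶠ y in 𝓝 x, d / 3 < ‖y - p‖ :=
          (continuous_id.sub continuous_const).norm.continuousAt.eventually_const_lt
            (by linarith : d / 3 < ‖x - p‖)
        filter_upwards [this] with y hy
        have hy0 : 0 < ‖y - p‖ := by linarith [hr.trans hr₁]
        have h1 : 1 ≤ c * ‖y - p‖ ^ 2 := by rw [← hcr]; gcongr; linarith
        have h2 : 1 ≤ c₀ * ‖y - p‖ ^ 2 := by
          have : c₀ * (d / 3) ^ 2 = 1 := by rw [hc₀]; field_simp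
          rw [← this]; gcongr
        rw [profile_of_one_le h1, profile_of_one_le h2, Real.mul_rpow hcpos.le (by positivity),
          Real.mul_rpow hc₀pos.le (by positivity), hc, inv_sq_rpow_neg hr,
          Real.rpow_neg hc₀pos.le, show 2 * m - γ = -γ + 2 * m by ring, Real.rpow_add hr]
        field_simp
      rw [lap_congr hev, lap_const_mul _ (hcdψ c₀).contDiffAt, abs_mul,
        abs_of_nonneg (by positivity)]
      calc c₀ ^ m * r ^ (2 * m - γ) * |lap (fun x => profile m (c₀ * ‖x - p‖ ^ 2) * ψ x) x|
          ≤ c₀ ^ m * r ^ (2 * m - γ) * CV := by gcongr; exact hCV x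
        _ = c₀ ^ m * CV * r ^ (2 * m - γ) := by ring
        _ ≤ η := hr₂
  · have hpt : ∀ y, y ≠ p → (r ^ (-γ) * (profile m (c * ‖y - p‖ ^ 2) * ψ y)) ^ lam ≤
        (ball p d).indicator (fun y => A ^ lam * r ^ ((θ - γ) * lam) *
          ‖y - p‖ ^ (-(θ * lam))) y := by
      intro y hy
      by_cases hyd : y ∈ ball p d
      · rw [indicator_of_mem hyd]
        have hy0 : 0 < ‖y - p‖ := norm_pos_iff.2 (sub_ne_zero.2 hy)
        have h1 := profile_le (m := m) (μ := θ / 2) (t := c * ‖y - p‖ ^ 2) (by linarith)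
          (by rw [hm]; linarith) (by positivity)
        have h2 : (c * ‖y - p‖ ^ 2) ^ (-(θ / 2)) = r ^ θ * ‖y - p‖ ^ (-θ) := by
          rw [Real.mul_rpow hcpos.le (by positivity), hc, inv_sq_rpow_neg hr,
            ← Real.rpow_natCast, ← Real.rpow_mul hy0.le]
          congr 2 <;> push_cast <;> ring
        have h3 : A ^ lam * r ^ ((θ - γ) * lam) * ‖y - p‖ ^ (-(θ * lam)) =
            (r ^ (-γ) * (A * (r ^ θ * ‖y - p‖ ^ (-θ)))) ^ lam := by
          rw [show r ^ (-γ) * (A * (r ^ θ * ‖y - p‖ ^ (-θ))) =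
            A * r ^ (θ - γ) * ‖y - p‖ ^ (-θ) by
              rw [show θ - γ = -γ + θ by ring, Real.rpow_add hr]; ring,
            Real.mul_rpow (by positivity) (by positivity),
            Real.mul_rpow (by positivity) (by positivity), ← Real.rpow_mul hr.le,
            ← Real.rpow_mul hy0.le]
          congr 2
          ring
        rw [h3]
        refine Real.rpow_le_rpow (mul_nonneg (by positivity)
          (mul_nonneg (profile_nonneg hm0) ψ.nonneg)) ?_ hlam.le
        refine mul_le_mul_of_nonneg_left ?_ (by positivity)
        rw [← h2]
        exact (mul_le_of_le_one_right (profile_nonneg hm0) ψ.le_one).trans h1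
      · rw [indicator_of_notMem hyd, hψout y (by
          rw [mem_ball, dist_eq_norm, not_lt] at hyd; exact hyd)]
        simp [Real.zero_rpow hlam.ne']
    have : Nontrivial (Euc n) := by
      apply Module.nontrivial_of_finrank_pos (R := ℝ)
      simp
      omega
    calc ∫⁻ y, ENNReal.ofReal ((r ^ (-γ) * (profile m (c * ‖y - p‖ ^ 2) * ψ y)) ^ lam)
        ≤ ∫⁻ y, (ball p d).indicator (fun y => ENNReal.ofReal (A ^ lam * r ^ ((θ - γ) * lam)) *
          ENNReal.ofReal (‖y - p‖ ^ (-(θ * lam)))) y := by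
          refine lintegral_mono_ae ?_
          filter_upwards [compl_mem_ae_iff.2 (measure_singleton p)] with y hy
          refine (ENNReal.ofReal_le_ofReal (hpt y hy)).trans ?_
          by_cases hyd : y ∈ ball p d
          · rw [indicator_of_mem hyd, indicator_of_mem hyd,
              ENNReal.ofReal_mul (by positivity)]
          · rw [indicator_of_notMem hyd, indicator_of_notMem hyd, ENNReal.ofReal_zero]
      _ = ENNReal.ofReal (A ^ lam * r ^ ((θ - γ) * lam)) * ENNReal.ofReal J := by
          rw [lintegral_indicator measurableSet_ball, lintegral_const_mul' _ _ ENNReal.ofReal_ne_top,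
            hJ']
      _ = ENNReal.ofReal (A ^ lam * J * r ^ ((θ - γ) * lam)) := by
          rw [← ENNReal.ofReal_mul (by positivity)]
          congr 1
          ring
      _ ≤ ENNReal.ofReal η := ENNReal.ofReal_le_ofReal hr₃

theorem exists_bump_exponents_of_lt {N α lam sig γ₀ : ℝ} (hγ₀ : 0 < γ₀) (hlam : 0 < lam)
    (h₁ : γ₀ ≤ N - 2) (h₂ : γ₀ * lam ≤ N)
    (h : γ₀ + 2 < γ₀ * sig ∨ γ₀ + 2 < γ₀ * (lam + sig) - (N - α)) :
    ∃ γ θ, 0 < γ ∧ γ < θ ∧ θ ≤ N - 2 ∧ θ * lam < N ∧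
      (γ + 2 < γ * sig ∨ γ + 2 < γ * (lam + sig) - (N - α)) := by
  have key : ∀ᶠ γ in 𝓝[<] γ₀, γ + 2 < γ * sig ∨ γ + 2 < γ * (lam + sig) - (N - α) := by
    refine nhdsWithin_le_nhds ?_
    rcases h with h | h
    · have : ∀ᶠ γ in 𝓝 γ₀, γ + 2 < γ * sig :=
        ContinuousAt.eventually_lt (by fun_prop) (by fun_prop) h
      exact this.mono fun _ => Or.inl
    · have : ∀ᶠ γ in 𝓝 γ₀, γ + 2 < γ * (lam + sig) - (N - α) :=
        ContinuousAt.eventually_lt (by fun_prop) (by fun_prop) h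
      exact this.mono fun _ => Or.inr
  have hpos : ∀ᶠ γ in 𝓝[<] γ₀, 0 < γ := nhdsWithin_le_nhds (Ioi_mem_nhds hγ₀)
  obtain ⟨γ, hγ, hγpos, hγlt⟩ := (key.and (hpos.and self_mem_nhdsWithin)).exists
  have hγlt' : γ < γ₀ := hγlt
  refine ⟨γ, (γ + γ₀) / 2, hγpos, by linarith, by linarith, ?_, hγ⟩
  have : (γ + γ₀) / 2 * lam < γ₀ * lam := by gcongr; linarith
  linarith

theorem exists_bump_exponents {n : ℕ} (hn : 3 ≤ n) {α lam sig : ℝ} (hα : 0 < α) (hlam : 0 < lam)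
    (hsig : gAlpha n α lam < sig) :
    ∃ γ θ : ℝ, 0 < γ ∧ γ < θ ∧ θ ≤ n - 2 ∧ θ * lam < n ∧
      (γ + 2 < γ * sig ∨ γ + 2 < γ * (lam + sig) - (n - α)) := by
  have hn' : (3 : ℝ) ≤ n := by exact_mod_cast hn
  have hm : (0 : ℝ) < n - 2 := by linarith
  unfold gAlpha at hsig
  split_ifs at hsig with h₁ h₂
  · rw [lt_div_iff₀ hm] at h₁
    rw [div_lt_iff₀ hm] at hsig
    exact exists_bump_exponents_of_lt hm hlam le_rfl (by linarith) (Or.inl (by linarith))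
  · rw [lt_div_iff₀ hm] at h₂
    rw [sub_lt_iff_lt_add, div_lt_iff₀ hm] at hsig
    exact exists_bump_exponents_of_lt hm hlam le_rfl (by linarith) (Or.inr (by linarith))
  · rw [not_lt, div_le_iff₀ hm] at h₂
    have hn0 : (0 : ℝ) < n := by linarith
    have h3 := (le_max_right _ _).trans_lt hsig
    refine exists_bump_exponents_of_lt (γ₀ := n / lam) (by positivity) hlam ?_ ?_ (Or.inr ?_)
    · rw [div_le_iff₀ hlam]; linarith
    · rw [div_mul_cancel₀ _ hlam.ne']
    · have h4 : (n / lam : ℝ) * (1 - (α - 2) / n * lam) < n / lam * sig := by gcongr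
      have h5 : (n / lam : ℝ) * (1 - (α - 2) / n * lam) = n / lam - (α - 2) := by
        field_simp
      have h6 : (n / lam : ℝ) * lam = n := div_mul_cancel₀ _ hlam.ne'
      linarith

theorem eventually_add_mul_rpow_neg_le {B C c e β : ℝ} (hB : 0 ≤ B) (hc : 0 < c)
    (he : 0 < e) (h : e < β) : ∀ᶠ r : ℝ in 𝓝[>] 0, B + C * r ^ (-e) ≤ c * r ^ (-β) := by
  have h₁ : ∀ᶠ r : ℝ in 𝓝[>] 0, (B + C) / c ≤ r ^ (-(β - e)) :=
    (tendsto_rpow_neg_nhdsGT_zero (by linarith)).eventually_ge_atTop _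
  have h₂ : ∀ᶠ r : ℝ in 𝓝[>] 0, r ≤ 1 := nhdsWithin_le_nhds (Iic_mem_nhds one_pos)
  filter_upwards [h₁, h₂, self_mem_nhdsWithin] with r hr₁ hr₂ (hr : 0 < r)
  rw [div_le_iff₀ hc] at hr₁
  have h3 : 1 ≤ r ^ (-e) := Real.one_le_rpow_of_pos_of_le_one_of_nonpos hr hr₂ (by linarith)
  calc B + C * r ^ (-e) ≤ B * r ^ (-e) + C * r ^ (-e) := by
        gcongr; exact le_mul_of_one_le_right hB h3
    _ = (B + C) * r ^ (-e) := by ring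
    _ ≤ (r ^ (-(β - e)) * c) * r ^ (-e) := by gcongr
    _ = c * (r ^ (-(β - e)) * r ^ (-e)) := by ring
    _ = c * r ^ (-β) := by
        rw [← Real.rpow_add hr]
        congr 2
        ring

theorem eventually_core_inequality {n : ℕ} {α lam sig γ B C c v : ℝ} (hB : 0 ≤ B)
    (hc : 0 < c) (hv : 0 < v) (hγ : 0 < γ) (hsig : 0 < sig)
    (h : γ + 2 < γ * sig ∨ γ + 2 < γ * (lam + sig) - (n - α)) :
    ∀ᶠ r : ℝ in 𝓝[>] 0, ∀ I U, c ≤ I → r ^ n * v * ((2 * r) ^ (-α) * (r ^ (-γ)) ^ lam) ≤ I →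
      r ^ (-γ) ≤ U → B + C * r ^ (-(γ + 2)) ≤ I * U ^ sig := by
  rcases h with h | h
  · filter_upwards [eventually_add_mul_rpow_neg_le (B := B) (C := C) (c := c) hB hc
      (by linarith : 0 < γ + 2) h, self_mem_nhdsWithin] with r hr (hr0 : 0 < r) I U hI _ hU
    refine hr.trans ?_
    rw [← neg_mul, Real.rpow_mul hr0.le]
    have : 0 ≤ I := hc.le.trans hI
    gcongr
  · filter_upwards [eventually_add_mul_rpow_neg_le (B := B) (C := C) (c := v * 2 ^ (-α)) hB
      (by positivity) (by linarith : 0 < γ + 2) h, self_mem_nhdsWithin]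
      with r hr (hr0 : 0 < r) I U hI hI' hU
    refine hr.trans ?_
    calc v * 2 ^ (-α) * r ^ (-(γ * (lam + sig) - (n - α)))
        = r ^ n * v * ((2 * r) ^ (-α) * (r ^ (-γ)) ^ lam) * (r ^ (-γ)) ^ sig := by
          rw [Real.mul_rpow two_pos.le hr0.le, ← Real.rpow_natCast r n, ← Real.rpow_mul hr0.le,
            ← Real.rpow_mul hr0.le, show -(γ * (lam + sig) - (n - α)) =
              (n : ℝ) + -α + -γ * lam + -γ * sig by ring, Real.rpow_add hr0, Real.rpow_add hr0,
            Real.rpow_add hr0]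
          ring
      _ ≤ I * U ^ sig := by
          have : 0 ≤ I := hc.le.trans hI
          gcongr

theorem integrable_kernel_mul {n : ℕ} (hn : 1 ≤ n) {α lam : ℝ} (hα0 : 0 < α) (hαn : α < n)
    (hlam : 0 < lam) {u : Euc n → ℝ} (hu0 : ∀ x, 0 ≤ u x) (hc : ContinuousOn u {0}ᶜ)
    (hi : Integrable (fun y => u y ^ lam)) {x : Euc n} (hx : x ≠ 0) :
    Integrable (fun y => ‖x - y‖ ^ (-α) * u y ^ lam) := by
  have hρ : 0 < ‖x‖ / 2 := by have := norm_pos_iff.2 hx; positivity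
  have hsub : closedBall x (‖x‖ / 2) ⊆ {0}ᶜ := by
    intro y hy h0
    rw [mem_singleton_iff.1 h0, mem_closedBall, dist_eq_norm, zero_sub, norm_neg] at hy
    linarith
  obtain ⟨M, hM⟩ := (isCompact_closedBall x (‖x‖ / 2)).bddAbove_image (hc.mono hsub)
  have hM' : ∀ y ∈ closedBall x (‖x‖ / 2), u y ≤ M := fun y hy => hM (mem_image_of_mem u hy)
  have hM0 : 0 ≤ M := (hu0 x).trans (hM' x (mem_closedBall_self hρ.le))
  have hg₁ : Integrable ((ball x (‖x‖ / 2)).indicator fun y => ‖y - x‖ ^ (-α)) :=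
    (integrable_indicator_iff measurableSet_ball).2 (integrableOn_norm_sub_rpow hn hαn x _)
  refine ((hg₁.const_mul (M ^ lam)).add (hi.const_mul ((‖x‖ / 2) ^ (-α)))).mono' ?_ ?_
  · exact ((measurable_const.sub measurable_id).norm.pow_const (-α)).aestronglyMeasurable.mul
      hi.aestronglyMeasurable
  · refine Eventually.of_forall fun y => ?_
    have hul : 0 ≤ u y ^ lam := Real.rpow_nonneg (hu0 y) _
    rw [Real.norm_of_nonneg (by positivity)]
    simp only [Pi.add_apply]
    by_cases hy : y ∈ ball x (‖x‖ / 2)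
    · rw [indicator_of_mem hy, norm_sub_rev x y, mul_comm]
      have := hM' y (ball_subset_closedBall hy)
      have h1 : u y ^ lam ≤ M ^ lam := Real.rpow_le_rpow (hu0 y) this hlam.le
      have h2 : u y ^ lam * ‖y - x‖ ^ (-α) ≤ M ^ lam * ‖y - x‖ ^ (-α) := by gcongr
      have h3 : 0 ≤ (‖x‖ / 2) ^ (-α) * u y ^ lam := by positivity
      linarith
    · rw [indicator_of_notMem hy, mul_zero, zero_add]
      rw [mem_ball, dist_eq_norm, not_lt, norm_sub_rev] at hy
      exact mul_le_mul_of_nonneg_right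
        (Real.rpow_le_rpow_of_nonpos hρ hy (by linarith)) hul

theorem le_integral_kernel_mul {n : ℕ} (hn : 1 ≤ n) {α lam : ℝ} (hα0 : 0 < α) (hlam : 0 < lam)
    {u : Euc n → ℝ} (hu0 : ∀ x, 0 ≤ u x) {x : Euc n}
    (hi : Integrable (fun y => ‖x - y‖ ^ (-α) * u y ^ lam)) {p : Euc n} {r R H : ℝ}
    (hH : 0 ≤ H) (hu : ∀ y ∈ closedBall p r, H ≤ u y ∧ ‖x - y‖ ≤ R) :
    volume.real (closedBall p r) * (R ^ (-α) * H ^ lam) ≤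
      ∫ y, ‖x - y‖ ^ (-α) * u y ^ lam := by
  have : Nontrivial (Euc n) := by
    apply Module.nontrivial_of_finrank_pos (R := ℝ)
    simp
    omega
  have hnn : ∀ y, 0 ≤ ‖x - y‖ ^ (-α) * u y ^ lam := fun y =>
    mul_nonneg (by positivity) (Real.rpow_nonneg (hu0 y) _)
  calc volume.real (closedBall p r) * (R ^ (-α) * H ^ lam)
      = ∫ _ in closedBall p r, R ^ (-α) * H ^ lam := by
        rw [setIntegral_const, smul_eq_mul]
    _ ≤ ∫ y in closedBall p r, ‖x - y‖ ^ (-α) * u y ^ lam := by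
        refine setIntegral_mono_on_ae (integrableOn_const measure_closedBall_lt_top.ne)
          hi.integrableOn measurableSet_closedBall ?_
        filter_upwards [compl_mem_ae_iff.2 (measure_singleton x)] with y hy hyp
        have hpos : 0 < ‖x - y‖ := norm_pos_iff.2 (sub_ne_zero.2 fun h => hy h.symm)
        have h1 := hu y hyp
        have h2 : R ^ (-α) ≤ ‖x - y‖ ^ (-α) :=
          Real.rpow_le_rpow_of_nonpos hpos h1.2 (by linarith)
        have h3 : H ^ lam ≤ u y ^ lam := Real.rpow_le_rpow hH h1.1 hlam.le
        exact mul_le_mul h2 h3 (by positivity) (by positivity)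
    _ ≤ ∫ y, ‖x - y‖ ^ (-α) * u y ^ lam :=
        setIntegral_le_integral hi (Eventually.of_forall hnn)

theorem exists_eventually_forall_ne_eq_zero {E : Type*} [NormedAddCommGroup E] {w : ℕ → E → ℝ}
    (hw : ∀ i y, w i y ≠ 0 →
      3 / 4 * (1 / 4 : ℝ) ^ (i + 1) < ‖y‖ ∧ ‖y‖ < 5 / 4 * (1 / 4 : ℝ) ^ (i + 1))
    {x : E} (hx : x ≠ 0) : ∃ j, ∀ᶠ y in 𝓝 x, ∀ i ≠ j, w i y = 0 := by
  have hx0 : 0 < ‖x‖ := norm_pos_iff.2 hx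
  have hex : ∃ j : ℕ, (1 / 4 : ℝ) ^ (j + 1) < 2 * ‖x‖ := by
    obtain ⟨j, hj⟩ := exists_pow_lt_of_lt_one (by positivity : 0 < 2 * ‖x‖)
      (by norm_num : (1 / 4 : ℝ) < 1)
    exact ⟨j, (pow_le_pow_of_le_one (by norm_num) (by norm_num) (Nat.le_succ j)).trans_lt hj⟩
  classical
  obtain ⟨j, hj, hmin⟩ : ∃ j : ℕ, (1 / 4 : ℝ) ^ (j + 1) < 2 * ‖x‖ ∧
      ∀ i < j, 2 * ‖x‖ ≤ (1 / 4 : ℝ) ^ (i + 1) :=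
    ⟨Nat.find hex, Nat.find_spec hex, fun i hi => not_lt.1 (Nat.find_min hex hi)⟩
  have e₁ : ∀ᶠ y in 𝓝 x, 5 / 16 * (1 / 4 : ℝ) ^ (j + 1) < ‖y‖ :=
    continuous_norm.continuousAt.eventually_const_lt (by
      have : (0 : ℝ) < (1 / 4 : ℝ) ^ (j + 1) := by positivity
      linarith)
  have e₂ : ∀ᶠ y in 𝓝 x, ‖y‖ < 3 / 2 * ‖x‖ :=
    continuous_norm.continuousAt.eventually_lt_const (by linarith)
  refine ⟨j, ?_⟩
  filter_upwards [e₁, e₂] with y hy₁ hy₂ i hij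
  by_contra hne
  obtain ⟨h1, h2⟩ := hw i y hne
  rcases lt_or_gt_of_ne hij with h | h
  · have := hmin i h
    linarith
  · have : (1 / 4 : ℝ) ^ (i + 1) ≤ (1 / 4 : ℝ) ^ (j + 1 + 1) :=
      pow_le_pow_of_le_one (by norm_num) (by norm_num) (by omega)
    rw [pow_succ _ (j + 1)] at this
    linarith

theorem exists_background (n : ℕ) {M : ℝ} (hM : 0 ≤ M) : ∃ U : Euc n → ℝ, ContDiff ℝ 2 U ∧
    (∀ x, 0 ≤ U x) ∧ HasCompactSupport U ∧ (∀ x ∈ ball (0 : Euc n) 2, M ≤ U x) ∧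
    ∀ x ∈ ball (0 : Euc n) 2, lap U x = -(2 * n) := by
  let ψ : ContDiffBump (0 : Euc n) := ⟨2, 3, by norm_num, by norm_num⟩
  have hcd : ContDiff ℝ 2 (fun x : Euc n => M + 9 - ‖x‖ ^ 2) :=
    contDiff_const.sub (contDiff_id.norm_sq ℝ)
  have hin : ∀ x ∈ ball (0 : Euc n) 2, ψ x = 1 := fun x hx =>
    ψ.one_of_mem_closedBall (ball_subset_closedBall hx)
  refine ⟨fun x => (M + 9 - ‖x‖ ^ 2) * ψ x, hcd.mul ψ.contDiff, fun x => ?_,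
    ψ.hasCompactSupport.mul_left, fun x hx => ?_, fun x hx => ?_⟩
  · rcases lt_or_ge ‖x‖ 3 with h | h
    · exact mul_nonneg (by nlinarith [norm_nonneg x]) ψ.nonneg
    · have : ψ x = 0 := ψ.zero_of_le_dist (by rw [dist_zero_right]; exact h)
      simp [this]
  · simp only [hin x hx, mul_one]
    rw [mem_ball_zero_iff] at hx
    nlinarith [norm_nonneg x]
  · have hev : (fun x => (M + 9 - ‖x‖ ^ 2) * ψ x) =ᶠ[𝓝 x]
        fun x => (fun t => M + 9 - t) (1 * ‖x - 0‖ ^ 2) := by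
      filter_upwards [isOpen_ball.mem_nhds hx] with y hy
      simp [hin y hy]
    rw [lap_congr hev, lap_radial (F := fun t => M + 9 - t) (F₁ := fun _ => -1) (F₂ := fun _ => 0)
      (fun t => (hasDerivAt_id t).const_sub _) (fun t => hasDerivAt_const t _)]
    ring

theorem lintegral_rpow_add_tsum_lt_top {n : ℕ} {lam : ℝ} (hlam : 0 < lam) {U : Euc n → ℝ}
    {w : ℕ → Euc n → ℝ} (hU : Continuous U) (hUc : HasCompactSupport U) (hU0 : ∀ x, 0 ≤ U x)
    (hw : ∀ i, Continuous (w i)) (hw0 : ∀ i x, 0 ≤ w i x)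
    (hwi : ∀ i, ∫⁻ x, ENNReal.ofReal (w i x ^ lam) ≤ ENNReal.ofReal ((1 / 2) ^ i))
    {u : Euc n → ℝ} (hu : ∀ x, ∃ i, u x = U x + w i x) :
    ∫⁻ x, ENNReal.ofReal (u x ^ lam) < ⊤ := by
  have hUi : ∫⁻ x, ENNReal.ofReal (U x ^ lam) < ⊤ := by
    have h : Integrable (fun x => U x ^ lam) := by
      refine Continuous.integrable_of_hasCompactSupport
        (hU.rpow_const fun _ => Or.inr hlam.le) ?_
      exact hUc.comp_left (g := fun t : ℝ => t ^ lam) (Real.zero_rpow hlam.ne')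
    exact (hasFiniteIntegral_iff_ofReal (Eventually.of_forall fun x =>
      Real.rpow_nonneg (hU0 x) _)).1 h.2
  have hsum : ∑' i : ℕ, ENNReal.ofReal ((1 / 2 : ℝ) ^ i) < ⊤ := by
    rw [← ENNReal.ofReal_tsum_of_nonneg (fun i => by positivity) summable_geometric_two]
    exact ENNReal.ofReal_lt_top
  have hpt : ∀ x, ENNReal.ofReal (u x ^ lam) ≤ ENNReal.ofReal (2 ^ lam) *
      (ENNReal.ofReal (U x ^ lam) + ∑' i, ENNReal.ofReal (w i x ^ lam)) := by
    intro x
    obtain ⟨i, hi⟩ := hu x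
    have h1 : u x ^ lam ≤ 2 ^ lam * (U x ^ lam + w i x ^ lam) := by
      have hUl := Real.rpow_nonneg (hU0 x) lam
      have hwl := Real.rpow_nonneg (hw0 i x) lam
      have h2 : (0 : ℝ) ≤ 2 ^ lam := by positivity
      rw [hi]
      rcases le_total (U x) (w i x) with h | h
      · calc (U x + w i x) ^ lam ≤ (2 * w i x) ^ lam :=
              Real.rpow_le_rpow (add_nonneg (hU0 x) (hw0 i x)) (by linarith) hlam.le
          _ = 2 ^ lam * w i x ^ lam := Real.mul_rpow two_pos.le (hw0 i x)
          _ ≤ _ := by gcongr; linarith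
      · calc (U x + w i x) ^ lam ≤ (2 * U x) ^ lam :=
              Real.rpow_le_rpow (add_nonneg (hU0 x) (hw0 i x)) (by linarith) hlam.le
          _ = 2 ^ lam * U x ^ lam := Real.mul_rpow two_pos.le (hU0 x)
          _ ≤ _ := by gcongr; linarith
    refine (ENNReal.ofReal_le_ofReal h1).trans ?_
    rw [ENNReal.ofReal_mul (by positivity),
      ENNReal.ofReal_add (Real.rpow_nonneg (hU0 x) _) (Real.rpow_nonneg (hw0 i x) _)]
    gcongr
    exact ENNReal.le_tsum (f := fun i => ENNReal.ofReal (w i x ^ lam)) i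
  have hmeas : ∀ {f : Euc n → ℝ}, Continuous f →
      Measurable fun x => ENNReal.ofReal (f x ^ lam) := fun hf =>
    (hf.measurable.pow_const lam).ennreal_ofReal
  refine (lintegral_mono hpt).trans_lt ?_
  rw [lintegral_const_mul' _ _ ENNReal.ofReal_ne_top, lintegral_add_left (hmeas hU),
    lintegral_tsum fun i => (hmeas (hw i)).aemeasurable]
  refine ENNReal.mul_lt_top ENNReal.ofReal_lt_top (ENNReal.add_lt_top.2 ⟨hUi, ?_⟩)
  exact (ENNReal.tsum_le_tsum hwi).trans_lt hsum

theorem gAlpha_nonneg {n : ℕ} (hn : 3 ≤ n) {α lam : ℝ} (hαn : α < n) : 0 ≤ gAlpha n α lam := by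
  have hn' : (3 : ℝ) ≤ n := by exact_mod_cast hn
  have hm : (0 : ℝ) < n - 2 := by linarith
  unfold gAlpha
  split_ifs with h₁ h₂
  · positivity
  · have : (2 * (n : ℝ) - α) / (n - 2) = n / (n - 2) + (n - α) / (n - 2) := by ring
    have : 0 < ((n : ℝ) - α) / (n - 2) := div_pos (by linarith) hm
    linarith
  · exact le_max_left _ _

theorem exists_spike {n : ℕ} (hn : 3 ≤ n) {α lam sig γ θ c v : ℝ} (hγ : 0 < γ) (hγθ : γ < θ)
    (hθ : θ ≤ n - 2) (hθl : θ * lam < n) (hlam : 0 < lam) (hsig : 0 < sig)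
    (hexp : γ + 2 < γ * sig ∨ γ + 2 < γ * (lam + sig) - (n - α)) (hc : 0 < c) (hv : 0 < v)
    (A : ℝ) (p : Euc n) {d η : ℝ} (hd : 0 < d) (hη : 0 < η) :
    ∃ r : ℝ, 0 < r ∧ A ≤ r ^ (-γ) ∧
      (∀ I V, c ≤ I → r ^ n * v * ((2 * r) ^ (-α) * (r ^ (-γ)) ^ lam) ≤ I →
        r ^ (-γ) ≤ V →
        2 * n + (((n : ℝ) - 2) / 2 * n * (n + 2)) * r ^ (-(γ + 2)) ≤ I * V ^ sig) ∧
      ∃ w : Euc n → ℝ, ContDiff ℝ 2 w ∧ (∀ x, 0 ≤ w x) ∧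
      (∀ x, d ≤ ‖x - p‖ → w x = 0) ∧
      (∀ x, ‖x - p‖ ≤ r → r ^ (-γ) ≤ w x ∧ lap w x ≤ 0 ∧
        -lap w x ≤ ((n : ℝ) - 2) / 2 * n * (n + 2) * r ^ (-(γ + 2))) ∧
      (∀ x, r < ‖x - p‖ → |lap w x| ≤ η) ∧
      ∫⁻ x, ENNReal.ofReal (w x ^ lam) ≤ ENNReal.ofReal η := by
  have e₁ : ∀ᶠ r : ℝ in 𝓝[>] 0, 0 < r := self_mem_nhdsWithin
  have e₂ : ∀ᶠ r : ℝ in 𝓝[>] 0, A ≤ r ^ (-γ) :=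
    (tendsto_rpow_neg_nhdsGT_zero (by linarith)).eventually_ge_atTop _
  exact (e₁.and (e₂.and ((eventually_core_inequality (by positivity) hc hv hγ hsig hexp).and
    (eventually_exists_bump hn hγ hγθ hθ hlam hθl p hd hη)))).exists

theorem stmt1 (n : ℕ) (hn : 3 ≤ n) (α lam sig : ℝ)
    (hα0 : 0 < α) (hαn : α < n) (hlam : 0 < lam)
    (hsig : gAlpha n α lam < sig)
    (φ : ℝ → ℝ) (hφc : ContinuousOn φ (Ioo 0 1))
    (hφp : ∀ t ∈ Ioo (0:ℝ) 1, 0 < φ t)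
    (hφl : Tendsto φ (𝓝[>] (0:ℝ)) atTop) :
    ∃ u : Euc n → ℝ, IsCPSolution n α lam sig u ∧ NotBigOAt n u φ := by
  have hn' : (3 : ℝ) ≤ n := by exact_mod_cast hn
  have hn1 : 1 ≤ n := by omega
  have hsig0 : 0 < sig := (gAlpha_nonneg hn hαn).trans_lt hsig
  obtain ⟨γ, θ, hγ, hγθ, hθ, hθl, hexp⟩ := exists_bump_exponents hn hα0 hlam hsig
  obtain ⟨v, hv⟩ : ∃ v, v = volume.real (closedBall (0 : Euc n) 1) := ⟨_, rfl⟩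
  have hv0 : 0 < v := by
    rw [hv]
    exact ENNReal.toReal_pos (measure_closedBall_pos volume _ one_pos).ne'
      measure_closedBall_lt_top.ne
  obtain ⟨c, hc⟩ : ∃ c : ℝ, c = v * 3 ^ (-α) := ⟨_, rfl⟩
  have hc0 : 0 < c := by rw [hc]; positivity
  obtain ⟨M, hM1, hM⟩ : ∃ M : ℝ, 1 ≤ M ∧ 2 * n + 1 ≤ c * M ^ lam * M ^ sig := by
    have h := ((tendsto_rpow_atTop (add_pos hlam hsig0)).const_mul_atTop hc0)
    obtain ⟨M, hM, hM1⟩ := ((h.eventually_ge_atTop (2 * n + 1)).and (eventually_ge_atTop 1)).exists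
    refine ⟨M, hM1, ?_⟩
    rwa [mul_assoc, ← Real.rpow_add (by linarith)]
  have hM0 : 0 ≤ M := by linarith
  obtain ⟨U, hUcd, hU0, hUc, hUM, hUlap⟩ := exists_background n hM0
  obtain ⟨q, hq⟩ : ∃ q : ℕ → ℝ, ∀ i, q i = (1 / 4 : ℝ) ^ (i + 1) := ⟨_, fun _ => rfl⟩
  have hq0 : ∀ i, 0 < q i := fun i => by rw [hq]; positivity
  have hq1 : ∀ i, q i < 1 := fun i => by
    rw [hq]; exact pow_lt_one₀ (by norm_num) (by norm_num) (Nat.succ_ne_zero i)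
  obtain ⟨p, hp⟩ : ∃ p : ℕ → Euc n, ∀ i, ‖p i‖ = q i :=
    ⟨fun i => EuclideanSpace.single ⟨0, by omega⟩ (q i), fun i => by
      simp [abs_of_pos (hq0 i)]⟩
  have hbump := fun i : ℕ => exists_spike hn hγ hγθ hθ hθl hlam hsig0 hexp hc0 hv0 (i * φ (q i))
    (p i) (by linarith [hq0 i] : 0 < q i / 4) (by positivity : (0 : ℝ) < (1 / 2) ^ i)
  choose r hr0 hrφ hcore w hwcd hw0 hwsupp hwin hwout hwint using hbump
  have hshell : ∀ i y, w i y ≠ 0 →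
      3 / 4 * (1 / 4 : ℝ) ^ (i + 1) < ‖y‖ ∧ ‖y‖ < 5 / 4 * (1 / 4 : ℝ) ^ (i + 1) := by
    intro i y hy
    have h1 : ‖y - p i‖ < q i / 4 := not_le.1 fun h => hy (hwsupp i y h)
    have h2 := norm_sub_norm_le y (p i)
    have h3 := norm_sub_norm_le (p i) y
    rw [norm_sub_rev] at h3
    rw [hp] at h2 h3
    rw [← hq]
    constructor <;> linarith
  have hw00 : ∀ i, w i 0 = 0 := fun i => by
    by_contra h
    have := (hshell i 0 h).1
    rw [norm_zero] at this
    have : (0 : ℝ) < (1 / 4) ^ (i + 1) := by positivity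
    linarith
  obtain ⟨u, hu⟩ : ∃ u : Euc n → ℝ, ∀ y, u y = U y + ∑' i, w i y := ⟨_, fun _ => rfl⟩
  have hloc : ∀ x : Euc n, x ≠ 0 →
      ∃ j, u =ᶠ[𝓝 x] (fun y => U y + w j y) ∧ ∀ i ≠ j, w i x = 0 := by
    intro x hx
    obtain ⟨j, hj⟩ := exists_eventually_forall_ne_eq_zero hshell hx
    refine ⟨j, ?_, hj.self_of_nhds⟩
    filter_upwards [hj] with y hy
    rw [hu, tsum_eq_single j hy]
  have hu_eq : ∀ x, ∃ j, u x = U x + w j x ∧ ∀ i ≠ j, w i x = 0 := by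
    intro x
    by_cases hx : x = 0
    · exact ⟨0, by simp [hu, hx, hw00], fun i _ => by rw [hx, hw00]⟩
    · obtain ⟨j, hj, hj'⟩ := hloc x hx
      exact ⟨j, hj.eq_of_nhds, hj'⟩
  have hUu : ∀ x, U x ≤ u x := fun x => by
    obtain ⟨j, hj, -⟩ := hu_eq x
    linarith [hw0 j x]
  have hu0 : ∀ x, 0 ≤ u x := fun x => (hU0 x).trans (hUu x)
  have hwu : ∀ i x, w i x ≤ u x := fun i x => by
    obtain ⟨j, hj, hj'⟩ := hu_eq x
    by_cases hij : i = j
    · rw [hij]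
      linarith [hU0 x]
    · rw [hj' i hij]
      exact hu0 x
  have hucd : ContDiffOn ℝ 2 u {0}ᶜ := fun x hx => by
    obtain ⟨j, hj, -⟩ := hloc x hx
    exact ((hUcd.add (hwcd j)).contDiffAt.congr_of_eventuallyEq hj).contDiffWithinAt
  have : Nontrivial (Euc n) := by
    apply Module.nontrivial_of_finrank_pos (R := ℝ)
    simp
    omega
  have huint : Integrable (fun y => u y ^ lam) := by
    have hae : AEStronglyMeasurable u volume := by
      have := hucd.continuousOn.aestronglyMeasurable (μ := volume)
        (measurableSet_singleton (0 : Euc n)).compl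
      rwa [restrict_compl_singleton] at this
    refine ⟨(hae.aemeasurable.pow_const lam).aestronglyMeasurable, ?_⟩
    rw [hasFiniteIntegral_iff_ofReal
      (Eventually.of_forall fun x => Real.rpow_nonneg (hu0 x) _)]
    exact lintegral_rpow_add_tsum_lt_top hlam hUcd.continuous hUc hU0
      (fun i => (hwcd i).continuous) hw0 hwint fun x => (hu_eq x).imp fun _ h => h.1
  refine ⟨u, ⟨hu0, hucd, huint, ?_⟩, p, fun j => ?_, ?_, ?_⟩
  · rintro x ⟨hx2, hx0 : x ≠ 0⟩
    obtain ⟨j, hj, -⟩ := hloc x hx0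
    have hlap : lap u x = -(2 * n) + lap (w j) x := by
      rw [lap_congr hj, lap_add hUcd.contDiffAt (hwcd j).contDiffAt, hUlap x hx2]
    have hker := integrable_kernel_mul hn1 hα0 hαn hlam hu0 hucd.continuousOn huint hx0
    set I : ℝ := ∫ y, ‖x - y‖ ^ (-α) * u y ^ lam with hI
    have hIM : c * M ^ lam ≤ I := by
      have h := le_integral_kernel_mul hn1 hα0 hlam hu0 hker (p := 0) (r := 1) (R := 3) hM0
        fun y hy => by
          rw [mem_closedBall_zero_iff] at hy
          rw [mem_ball_zero_iff] at hx2
          refine ⟨(hUM y ?_).trans (hUu y), ?_⟩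
          · rw [mem_ball_zero_iff]; linarith
          · linarith [norm_sub_le x y]
      rw [← hv] at h
      rw [hc, mul_assoc]
      exact h
    have hcI : c ≤ I := (le_mul_of_one_le_right hc0.le
      (Real.one_le_rpow hM1 hlam.le)).trans hIM
    have hMu : M ≤ u x := (hUM x hx2).trans (hUu x)
    rcases le_or_gt ‖x - p j‖ (r j) with h | h
    · obtain ⟨h1, h2, h3⟩ := hwin j x h
      have hIr : r j ^ n * v * ((2 * r j) ^ (-α) * (r j ^ (-γ)) ^ lam) ≤ I := by
        have h := le_integral_kernel_mul hn1 hα0 hlam hu0 hker (p := p j) (r := r j)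
          (R := 2 * r j) (H := r j ^ (-γ)) (Real.rpow_nonneg (hr0 j).le _) fun y hy => by
            rw [mem_closedBall, dist_eq_norm] at hy
            refine ⟨(hwin j y hy).1.trans (hwu j y), ?_⟩
            have := norm_sub_le (x - p j) (y - p j)
            rw [sub_sub_sub_cancel_right] at this
            linarith
        rwa [Measure.addHaar_real_closedBall' _ _ (hr0 j).le, finrank_euclideanSpace_fin,
          ← hv] at h
      have := hcore j I (u x) hcI hIr (h1.trans (hwu j x))
      rw [hlap]
      have hnn : (0 : ℝ) ≤ 2 * n := by positivity
      constructor <;> linarith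
    · have h1 := hwout j x h
      have h2 : (1 / 2 : ℝ) ^ j ≤ 1 := pow_le_one₀ (by norm_num) (by norm_num)
      have h3 := abs_le.1 (h1.trans h2)
      have h4 : c * M ^ lam * M ^ sig ≤ I * u x ^ sig := by
        exact mul_le_mul hIM (Real.rpow_le_rpow hM0 hMu hsig0.le) (Real.rpow_nonneg hM0 _)
          (hc0.le.trans hcI)
      rw [hlap]
      constructor <;> linarith [h3.1, h3.2]
  · rw [← norm_pos_iff, hp]
    exact hq0 j
  · rw [tendsto_zero_iff_norm_tendsto_zero]
    simp_rw [hp, hq]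
    exact (tendsto_pow_atTop_nhds_zero_of_lt_one (by norm_num) (by norm_num)).comp
      (tendsto_add_atTop_nat 1)
  · refine tendsto_atTop_mono (fun j => ?_) tendsto_natCast_atTop_atTop
    rw [hp, le_div_iff₀ (hφp _ ⟨hq0 j, hq1 j⟩)]
    refine (hrφ j).trans (((hwin j (p j) ?_).1).trans (hwu j _))
    simpa using (hr0 j).le
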